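/- Let G₁ = (V, E₁) and G₂ = (V, E₂) be simple undirected graphs on the same vertex set V with disjoint edge sets E₁ ∩ E₂ = ∅, and let G = (V, E₁ ∪ E₂) be their union. Then |gc(G₁) − gc(G₂)| ≤ gc(G) ≤ gc(G₁) + gc(G₂). -/

import Mathlib

open Matrix

def GCFeasible {V : Type*} [Fintype V] (A : Matrix V V ℝ) (m : ℕ) : Prop :=
  ∃ (k : ℕ) (P : Matrix (Fin k) V ℝ) (w : Fin k → ℝ),
    (∀ p i, P p i = 1 ∨ P p i = -1) ∧
    (∀ i, A i i = 0) ∧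
    (∀ i j, i ≠ j → A i j = (Pᵀ * Matrix.diagonal w * P) i j) ∧
    m = (Finset.univ.filter fun p => w p ≠ 0).card

noncomputable def gc {V : Type*} [Fintype V] (A : Matrix V V ℝ) : ℕ :=
  sInf { m | GCFeasible A m }

open scoped Classical in
noncomputable def gcGraph {V : Type*} [Fintype V] (G : SimpleGraph V) : ℕ :=
  gc (Matrix.of fun u v => if G.Adj u v then (1 : ℝ) else 0)

/-- A weighted family of sign vectors over any finite index type witnesses feasibility. -/
theorem GCFeasible.of_fintype {V ι : Type*} [Fintype V] [Fintype ι] {A : Matrix V V ℝ}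
    (P : ι → V → ℝ) (w : ι → ℝ) (hP : ∀ p i, P p i = 1 ∨ P p i = -1)
    (hA : ∀ i, A i i = 0) (hs : ∀ i j, i ≠ j → A i j = ∑ p, w p * (P p i * P p j)) :
    GCFeasible A (Finset.univ.filter fun p => w p ≠ 0).card := by
  let e := Fintype.equivFin ι
  refine ⟨Fintype.card ι, Matrix.of fun p i => P (e.symm p) i, fun p => w (e.symm p),
    fun p i => hP _ i, hA, fun i j hij => ?_, ?_⟩
  · rw [hs i j hij, Matrix.mul_apply, ← e.symm.sum_comp]
    refine Finset.sum_congr rfl fun p _ => ?_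
    simp only [Matrix.mul_diagonal, Matrix.transpose_apply, Matrix.of_apply]
    ring
  · refine Finset.card_equiv e fun p => ?_
    simp

theorem GCFeasible.add_smul {V : Type*} [Fintype V] {A B : Matrix V V ℝ} {m n : ℕ}
    (hA : GCFeasible A m) (hB : GCFeasible B n) {c : ℝ} (hc : c ≠ 0) :
    GCFeasible (A + c • B) (m + n) := by
  obtain ⟨k, P, w, hP, hA0, hAs, rfl⟩ := hA
  obtain ⟨l, Q, z, hQ, hB0, hBs, rfl⟩ := hB
  have key := GCFeasible.of_fintype (A := A + c • B) (Sum.elim (fun p i => P p i) fun p i => Q p i)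
    (Sum.elim w fun p => c * z p) (by rintro (p | p) i <;> simp [hP, hQ])
    (fun i => by simp [hA0, hB0]) (fun i j hij => by
      rw [Fintype.sum_sum_type, Matrix.add_apply, Matrix.smul_apply, hAs i j hij, hBs i j hij,
        Matrix.mul_apply, Matrix.mul_apply, smul_eq_mul, Finset.mul_sum]
      congr 1 <;> refine Finset.sum_congr rfl fun p _ => ?_ <;>
        simp only [Matrix.mul_diagonal, Matrix.transpose_apply, Sum.elim_inl, Sum.elim_inr] <;>
        ring)
  convert key using 1
  simp only [Finset.card_filter, Fintype.sum_sum_type, Sum.elim_inl, Sum.elim_inr, ne_eq,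
    mul_eq_zero, hc, false_or]
  congr!

/-- Every symmetric matrix with zero diagonal is realized by some coupling. -/
theorem exists_gcFeasible {V : Type*} [Fintype V] {A : Matrix V V ℝ} (hA : A.IsSymm)
    (h0 : ∀ i, A i i = 0) : ∃ m, GCFeasible A m := by
  classical
  refine ⟨_, GCFeasible.of_fintype (ι := V × V × Bool × Bool)
    (fun p i => (if p.2.2.1 ∧ i = p.1 then -1 else 1) *
      (if p.2.2.2 ∧ i = p.2.1 then -1 else 1))
    (fun p => A p.1 p.2.1 / 8 * ((if p.2.2.1 then -1 else 1) * (if p.2.2.2 then -1 else 1)))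
    (fun p i => by split_ifs <;> norm_num) h0 fun i j hij => ?_⟩
  have flip (u : V) : 1 - (if i = u then (-1 : ℝ) else 1) * (if j = u then -1 else 1) =
      2 * ((if i = u then 1 else 0) + (if j = u then 1 else 0)) := by
    split_ifs with h1 h2
    · exact absurd (h1.trans h2.symm) hij
    all_goals norm_num
  have term (u v : V) : (∑ x : Bool × Bool,
      A u v / 8 * ((if x.1 then -1 else 1) * (if x.2 then -1 else 1)) *
        (((if x.1 ∧ i = u then -1 else 1) * (if x.2 ∧ i = v then -1 else 1)) *
          ((if x.1 ∧ j = u then -1 else 1) * (if x.2 ∧ j = v then -1 else 1)))) =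
      A u v / 2 * (((if i = u then 1 else 0) + (if j = u then 1 else 0)) *
        ((if i = v then 1 else 0) + (if j = v then 1 else 0))) := by
    simp only [Fintype.sum_prod_type, Fintype.sum_bool, true_and, false_and, if_true, if_false,
      Bool.false_eq_true]
    linear_combination (A u v / 8 * (1 - (if i = v then (-1 : ℝ) else 1) *
      (if j = v then -1 else 1))) * flip u + (A u v / 4 *
        ((if i = u then 1 else 0) + (if j = u then 1 else 0))) * flip v
  rw [Fintype.sum_prod_type]
  simp_rw [Fintype.sum_prod_type (α₁ := V), term]
  simp only [mul_add, mul_ite, mul_one, mul_zero, Finset.sum_add_distrib,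
    Finset.sum_ite_eq, Finset.mem_univ, if_true, h0, zero_div]
  simp [hA.apply i j]

theorem gc_add_smul_le {V : Type*} [Fintype V] {A B : Matrix V V ℝ}
    (hA : A.IsSymm) (hA0 : ∀ i, A i i = 0) (hB : B.IsSymm) (hB0 : ∀ i, B i i = 0)
    {c : ℝ} (hc : c ≠ 0) : gc (A + c • B) ≤ gc A + gc B :=
  Nat.sInf_le <| GCFeasible.add_smul (Nat.sInf_mem (exists_gcFeasible hA hA0))
    (Nat.sInf_mem (exists_gcFeasible hB hB0)) hc

open scoped Classical in
/-- A real linear combination of adjacency matrices bounds the coupling number. -/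
theorem gcGraph_le_add {V : Type*} [Fintype V] {G H K : SimpleGraph V} {c : ℝ} (hc : c ≠ 0)
    (h : ∀ u v, (if G.Adj u v then (1 : ℝ) else 0) =
      (if H.Adj u v then 1 else 0) + c * (if K.Adj u v then 1 else 0)) :
    gcGraph G ≤ gcGraph H + gcGraph K := by
  have hG : (Matrix.of fun u v => if G.Adj u v then (1 : ℝ) else 0) =
      (Matrix.of fun u v => if H.Adj u v then (1 : ℝ) else 0) +
        c • Matrix.of fun u v => if K.Adj u v then (1 : ℝ) else 0 := by
    ext u v
    simpa only [Matrix.add_apply, Matrix.smul_apply, Matrix.of_apply, smul_eq_mul] using h u v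
  unfold gcGraph
  rw [hG]
  refine gc_add_smul_le ?_ ?_ ?_ ?_ hc
  · exact Matrix.IsSymm.ext fun u v => by simp [H.adj_comm]
  · simp
  · exact Matrix.IsSymm.ext fun u v => by simp [K.adj_comm]
  · simp

/-- Theorem: for edge-disjoint graphs G₁, G₂ on the same vertex set,
|gc(G₁) − gc(G₂)| ≤ gc(G₁ ∪ G₂) ≤ gc(G₁) + gc(G₂). -/
theorem gc_union_bounds {V : Type*} [Fintype V] (G₁ G₂ : SimpleGraph V)
    (h : Disjoint G₁ G₂) :
    |(gcGraph G₁ : ℤ) - (gcGraph G₂ : ℤ)| ≤ (gcGraph (G₁ ⊔ G₂) : ℤ) ∧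
    gcGraph (G₁ ⊔ G₂) ≤ gcGraph G₁ + gcGraph G₂ := by
  have hd (u v : V) : ¬(G₁.Adj u v ∧ G₂.Adj u v) := fun ⟨h₁, h₂⟩ =>
    (disjoint_iff_inf_le.mp h : G₁ ⊓ G₂ ≤ ⊥) (show (G₁ ⊓ G₂).Adj u v from ⟨h₁, h₂⟩)
  have hU : gcGraph (G₁ ⊔ G₂) ≤ gcGraph G₁ + gcGraph G₂ :=
    gcGraph_le_add one_ne_zero fun u v => by
      have := hd u v
      by_cases h₁ : G₁.Adj u v <;> by_cases h₂ : G₂.Adj u v <;> simp_all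
  have hL₁ : gcGraph G₁ ≤ gcGraph (G₁ ⊔ G₂) + gcGraph G₂ :=
    gcGraph_le_add (neg_ne_zero.mpr one_ne_zero) fun u v => by
      have := hd u v
      by_cases h₁ : G₁.Adj u v <;> by_cases h₂ : G₂.Adj u v <;> simp_all
  have hL₂ : gcGraph G₂ ≤ gcGraph (G₁ ⊔ G₂) + gcGraph G₁ :=
    gcGraph_le_add (neg_ne_zero.mpr one_ne_zero) fun u v => by
      have := hd u v
      by_cases h₁ : G₁.Adj u v <;> by_cases h₂ : G₂.Adj u v <;> simp_all
  exact ⟨abs_sub_le_iff.mpr ⟨by omega, by omega⟩, hU⟩
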